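/- If p ∤ r, then for every integer i with 1 ≤ i < p and every function θ : G_{l−1} → ℂ, τ_l(ν^i·(θ∘π)) = Σ_X ν₀(det X)^i·θ(π(X))·e(Tr X), where the sum runs over all X ∈ G_l whose entries satisfy X₁₂ ≡ X₂₁ ≡ 0 (mod p) and r·X₁₁ ≡ r·X₂₂ ≡ −i (mod p); i.e., all terms of the full Gauss sum outside this congruence-constrained set cancel. (§3.5 final formula.) -/

import Mathlib

noncomputable section
open Matrix Complex

/-- The additive character `x ↦ ζ_N^{r·x} = exp(2πi·r·x/N)` of `ZMod N`. -/
def aChar (N : ℕ) (r : ℤ) (x : ZMod N) : ℂ :=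
  Complex.exp (2 * Real.pi * Complex.I * (r : ℂ) * (x.val : ℂ) / (N : ℂ))

/-- The Gauss sum `τ_l(χ) = Σ_{X ∈ GL₂(ℤ/N)} χ(X) e(Tr X)` with `e = aChar N r`. -/
def tauGL (N : ℕ) [NeZero N] (r : ℤ) (χ : GL (Fin 2) (ZMod N) → ℂ) : ℂ :=
  ∑ X : GL (Fin 2) (ZMod N), χ X * aChar N r (Matrix.trace X.val)

/-- The reduction homomorphism `π : GL₂(ℤ/p^l) → GL₂(ℤ/p^{l-1})`. -/
def piGL (p l : ℕ) : GL (Fin 2) (ZMod (p ^ l)) →* GL (Fin 2) (ZMod (p ^ (l - 1))) :=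
  Units.map
    ((ZMod.castHom (pow_dvd_pow p (Nat.sub_le l 1)) (ZMod (p ^ (l - 1)))).mapMatrix).toMonoidHom

/-- If `F` transforms under right translation by each `k j` through a factor `ψ j` that is itself
invariant under all these translations, then only the terms where every factor is `1` contribute
to the sum of `F`. -/
lemma sum_eq_sum_indicator_of_mul_right {G ι : Type*} [Group G] [Fintype G] (F : G → ℂ)
    (k : ι → G) (ψ : ι → G → ℂ) (hF : ∀ j X, F (X * k j) = ψ j X * F X)
    (hψ : ∀ j j' X, ψ j (X * k j') = ψ j X) (s : Finset ι) :
    ∑ X, F X = ∑ X, Set.indicator {Y | ∀ j ∈ s, ψ j Y = 1} F X := by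
  classical
  induction s using Finset.induction_on with
  | empty => simp
  | insert a s _ ih =>
    rw [ih, ← sub_eq_zero, ← Finset.sum_sub_distrib]
    set g : G → ℂ := fun X => Set.indicator {Y | ∀ j ∈ s, ψ j Y = 1} F X / (ψ a X - 1) with hg
    have hgk : ∀ X, g (X * k a) = ψ a X * g X := by
      intro X
      simp only [hg, Set.indicator_apply, Set.mem_ofPred_eq, hψ, hF]
      split_ifs <;> ring
    have hterm : ∀ X, Set.indicator {Y | ∀ j ∈ s, ψ j Y = 1} F X -
        Set.indicator {Y | ∀ j ∈ insert a s, ψ j Y = 1} F X = g (X * k a) - g X := by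
      intro X
      rw [hgk]
      simp only [hg, Set.indicator_apply, Set.mem_ofPred_eq, Finset.forall_mem_insert]
      by_cases h : ψ a X = 1
      · simp [h]
      · have h' : ψ a X - 1 ≠ 0 := sub_ne_zero.mpr h
        simp only [h, false_and, if_false, sub_zero]
        field_simp
    rw [Finset.sum_congr rfl fun X _ => hterm X, Finset.sum_sub_distrib, sub_eq_zero]
    exact Fintype.sum_equiv (Equiv.mulRight (k a)) _ _ fun _ => rfl

lemma aChar_eq_stdAddChar (N : ℕ) [NeZero N] (r : ℤ) (x : ZMod N) :
    aChar N r x = ZMod.stdAddChar ((r : ZMod N) * x) := by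
  have h : (r : ZMod N) * x = ((r * (x.val : ℤ) : ℤ) : ZMod N) := by simp
  rw [h, ZMod.stdAddChar_coe, aChar]
  push_cast
  ring_nf

lemma stdAddChar_pow_mul (p l : ℕ) [NeZero p] (hl : l ≠ 0) (y : ZMod (p ^ l)) :
    ZMod.stdAddChar ((p : ZMod (p ^ l)) ^ (l - 1) * y) =
      ZMod.stdAddChar (ZMod.castHom (dvd_pow_self p hl) (ZMod p) y) := by
  obtain ⟨n, rfl⟩ := ZMod.intCast_surjective y
  have h : (p : ZMod (p ^ l)) ^ (l - 1) * (n : ZMod (p ^ l)) =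
      (((p : ℤ) ^ (l - 1) * n : ℤ) : ZMod (p ^ l)) := by push_cast; rfl
  rw [h, map_intCast (ZMod.castHom (dvd_pow_self p hl) (ZMod p)),
    ZMod.stdAddChar_coe, ZMod.stdAddChar_coe]
  obtain ⟨m, rfl⟩ := Nat.exists_eq_succ_of_ne_zero hl
  have hp : (p : ℂ) ≠ 0 := Nat.cast_ne_zero.mpr (NeZero.ne p)
  congr 1
  push_cast
  rw [pow_succ]
  field_simp

lemma stdAddChar_eq_one_iff {N : ℕ} [NeZero N] (x : ZMod N) :
    ZMod.stdAddChar x = 1 ↔ x = 0 := by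
  rw [← AddChar.map_zero_eq_one (ZMod.stdAddChar (N := N)), ZMod.injective_stdAddChar.eq_iff]

lemma single_mul_self_eq_zero {R : Type*} [CommRing R] (c : R) (hc : c * c = 0) (a b : Fin 2) :
    Matrix.single a b c * Matrix.single a b c = 0 := by
  by_cases h : b = a
  · subst h; simp [hc]
  · exact Matrix.single_mul_single_of_ne _ _ _ _ h _

/-- The matrix `1 + c E_{ab}` as a unit, where `c ^ 2 = 0`. -/
def oneAddSingle {R : Type*} [CommRing R] (c : R) (hc : c * c = 0) (a b : Fin 2) :
    GL (Fin 2) R where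
  val := 1 + Matrix.single a b c
  inv := 1 - Matrix.single a b c
  val_inv := by
    rw [add_mul, mul_sub, mul_sub, single_mul_self_eq_zero c hc]; simp
  inv_val := by
    rw [sub_mul, mul_add, mul_add, single_mul_self_eq_zero c hc]; simp

section oneAddSingle

variable {R : Type*} [CommRing R] (c : R) (hc : c * c = 0) (a b : Fin 2)

lemma det_oneAddSingle :
    (oneAddSingle c hc a b).val.det = 1 + if a = b then c else 0 := by
  fin_cases a <;> fin_cases b <;> simp [oneAddSingle, Matrix.det_fin_two, Matrix.single]

lemma trace_mul_oneAddSingle (X : Matrix (Fin 2) (Fin 2) R) :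
    (X * (oneAddSingle c hc a b).val).trace = X.trace + c * X b a := by
  simp [oneAddSingle, mul_add, Matrix.trace_mul_single, mul_comm]

lemma map_mul_oneAddSingle {S : Type*} [CommRing S] (f : R →+* S) (hf : f c = 0)
    (X : Matrix (Fin 2) (Fin 2) R) (m n : Fin 2) :
    f ((X * (oneAddSingle c hc a b).val) m n) = f (X m n) := by
  fin_cases a <;> fin_cases b <;> fin_cases m <;> fin_cases n <;>
    simp [oneAddSingle, Matrix.mul_apply, Matrix.single, hf]

end oneAddSingle

/-- §3.5 final formula: if `p ∤ r`, then for `1 ≤ i < p` the Gauss sum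
`τ_l(ν^i·(θ∘π))` equals the partial sum over those `X ∈ G_l` with
`X₁₂ ≡ X₂₁ ≡ 0 (mod p)` and `r·X₁₁ ≡ r·X₂₂ ≡ −i (mod p)`; i.e. all other terms of
the full Gauss sum cancel. -/
theorem gauss_sum_X4_final (p l : ℕ) [Fact p.Prime] (hp : Odd p) (hl : 2 ≤ l)
    (r : ℤ) (hr : ¬ ((p : ℤ) ^ l ∣ r)) (hpr : ¬ ((p : ℤ) ∣ r))
    (ν₀ : ZMod (p ^ l) → ℂ)
    (hνmul : ∀ x y : ZMod (p ^ l), IsUnit x → IsUnit y → ν₀ (x * y) = ν₀ x * ν₀ y)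
    (hνne : ∀ x : ZMod (p ^ l), IsUnit x → ν₀ x ≠ 0)
    (hν : ν₀ (1 + (p : ZMod (p ^ l)) ^ (l - 1)) =
      Complex.exp (2 * Real.pi * Complex.I / (p : ℂ)))
    (i : ℕ) (hi1 : 1 ≤ i) (hip : i < p)
    (θ : GL (Fin 2) (ZMod (p ^ (l - 1))) → ℂ) :
    tauGL (p ^ l) r (fun X => ν₀ X.val.det ^ i * θ (piGL p l X)) =
      ∑ X : GL (Fin 2) (ZMod (p ^ l)),
        Set.indicator
          {Y : GL (Fin 2) (ZMod (p ^ l)) |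
            ZMod.castHom (dvd_pow_self p (by omega : l ≠ 0)) (ZMod p) (Y.val 0 1) = 0 ∧
            ZMod.castHom (dvd_pow_self p (by omega : l ≠ 0)) (ZMod p) (Y.val 1 0) = 0 ∧
            (r : ZMod p) *
              ZMod.castHom (dvd_pow_self p (by omega : l ≠ 0)) (ZMod p) (Y.val 0 0) =
              -(i : ZMod p) ∧
            (r : ZMod p) *
              ZMod.castHom (dvd_pow_self p (by omega : l ≠ 0)) (ZMod p) (Y.val 1 1) =
              -(i : ZMod p)}
          (fun Y => ν₀ Y.val.det ^ i * θ (piGL p l Y) *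
            aChar (p ^ l) r (Matrix.trace Y.val)) X := by
  classical
  have hl0 : l ≠ 0 := by omega
  set c : ZMod (p ^ l) := (p : ZMod (p ^ l)) ^ (l - 1) with hc_def
  have hc : c * c = 0 := by
    have h : (p : ZMod (p ^ l)) ^ l = 0 := by exact_mod_cast ZMod.natCast_self (p ^ l)
    rw [hc_def, ← pow_add, show l - 1 + (l - 1) = l + (l - 2) by omega, pow_add, h, zero_mul]
  have hcp : ZMod.castHom (dvd_pow_self p hl0) (ZMod p) c = 0 := by
    rw [hc_def, map_pow, map_natCast, ZMod.natCast_self, zero_pow (by omega)]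
  have hcpi : ZMod.castHom (pow_dvd_pow p (Nat.sub_le l 1)) (ZMod (p ^ (l - 1))) c = 0 := by
    rw [hc_def, map_pow, map_natCast]
    exact_mod_cast ZMod.natCast_self (p ^ (l - 1))
  set red := ZMod.castHom (dvd_pow_self p hl0) (ZMod p) with hred
  have hν1 : ν₀ 1 = 1 := by
    have h := hνmul 1 1 isUnit_one isUnit_one
    rw [mul_one] at h
    exact (mul_eq_left₀ (hνne 1 isUnit_one)).mp h.symm
  have hνdet : ∀ a b, ν₀ (oneAddSingle c hc a b).val.det ^ i =
      ZMod.stdAddChar (if a = b then (i : ZMod p) else 0) := by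
    intro a b
    rw [det_oneAddSingle]
    split_ifs
    · have h : Complex.exp (2 * Real.pi * Complex.I / (p : ℂ)) =
          ZMod.stdAddChar (1 : ZMod p) := by
        simpa using (ZMod.stdAddChar_coe (N := p) 1).symm
      rw [hν, h, ← AddChar.map_nsmul_eq_pow, nsmul_one]
    · simp [hν1]
  have hpi : ∀ X a b, piGL p l (X * oneAddSingle c hc a b) = piGL p l X := by
    intro X a b
    ext m n
    exact map_mul_oneAddSingle c hc a b _ hcpi X.val m n
  have hdetunit : ∀ X : GL (Fin 2) (ZMod (p ^ l)), IsUnit X.val.det :=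
    fun X => (Matrix.isUnit_iff_isUnit_det _).mp X.isUnit
  have hr0 : (r : ZMod p) ≠ 0 := fun h => hpr ((ZMod.intCast_zmod_eq_zero_iff_dvd r p).mp h)
  rw [tauGL, sum_eq_sum_indicator_of_mul_right _
    (fun j : Fin 2 × Fin 2 => oneAddSingle c hc j.1 j.2)
    (fun j X => ZMod.stdAddChar
      ((if j.1 = j.2 then (i : ZMod p) else 0) + (r : ZMod p) * red (X.val j.2 j.1)))
    ?_ ?_ Finset.univ]
  · refine Finset.sum_congr rfl fun X _ => ?_
    congr 1
    ext Y
    simp only [stdAddChar_eq_one_iff, Set.mem_ofPred_eq, Finset.mem_univ, true_implies,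
      Prod.forall, Fin.forall_fin_two, hred]
    simp [hr0, add_comm (i : ZMod p), ← eq_neg_iff_add_eq_zero]
    tauto
  · rintro ⟨a, b⟩ X
    simp only [hpi, Units.val_mul, Matrix.det_mul]
    rw [hνmul _ _ (hdetunit X) (hdetunit _), mul_pow, hνdet, trace_mul_oneAddSingle,
      aChar_eq_stdAddChar, aChar_eq_stdAddChar, mul_add, AddChar.map_add_eq_mul,
      mul_left_comm (r : ZMod (p ^ l)) c, hc_def, stdAddChar_pow_mul p l hl0, ← hred, map_mul red,
      map_intCast red, AddChar.map_add_eq_mul]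
    ring
  · rintro ⟨a, b⟩ ⟨a', b'⟩ X
    simp only [Units.val_mul]
    rw [map_mul_oneAddSingle c hc a' b' red hcp]
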